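/- arXiv:1204.0187 — 2 statements merged into one kernel-verified Lean document; each statement's English description precedes it below -/
import Mathlib

section
/- For all integers k ≥ 0 and r ≥ 1 there exists a unique sequence of Laurent polynomials (P_{k,i}^{(r)}(q))_{i=k}^{rk} in q with nonnegative integer coefficients such that for every integer n ≥ k one has [n choose k]_q^r · [n+k choose k]_q^r = ∑_{i=k}^{min(n,rk)} q^{(rk−i)n} · [n choose i]_q · [n+i choose i]_q · P_{k,i}^{(r)}(q). -/
open Polynomial LaurentPolynomial Finset

/-- The Gaussian (q-)binomial coefficient `[n choose k]_q` as a polynomial in `q`,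
defined by the q-Pascal recursion; it equals `(q)_n / ((q)_k (q)_{n-k})` for `0 ≤ k ≤ n`
and vanishes for `k > n`. -/
noncomputable def qbinom : ℕ → ℕ → Polynomial ℤ
  | _, 0 => 1
  | 0, _ + 1 => 0
  | n + 1, k + 1 => qbinom n k + Polynomial.X ^ (k + 1) * qbinom n (k + 1)

/-- `[n choose k]_q` viewed as a Laurent polynomial. -/
noncomputable def qb (n k : ℕ) : LaurentPolynomial ℤ := (qbinom n k).toLaurent

/-- The Laurent polynomials all of whose coefficients are nonnegative. -/
def nonnegCoeff : Subsemiring (LaurentPolynomial ℤ) where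
  carrier := {f | ∀ m : ℤ, 0 ≤ f.coeff m}
  zero_mem' m := by simp
  one_mem' m := by
    rw [← T_zero, T_apply]
    split_ifs <;> simp
  add_mem' hf hg m := by simpa using add_nonneg (hf m) (hg m)
  mul_mem' {f g} hf hg m := by
    rw [AddMonoidAlgebra.coeff_mul]
    refine Finset.sum_nonneg fun a _ => Finset.sum_nonneg fun b _ => ?_
    dsimp only
    split_ifs
    · exact mul_nonneg (hf a) (hg b)
    · rfl

lemma T_mem_nonnegCoeff (a : ℤ) : (T a : LaurentPolynomial ℤ) ∈ nonnegCoeff := fun m => by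
  rw [T_apply]
  split_ifs <;> simp

lemma one_sub_T_ne_zero {a : ℤ} (ha : a ≠ 0) : (1 - T a : LaurentPolynomial ℤ) ≠ 0 := by
  intro h
  have h1 := congrArg (fun f : LaurentPolynomial ℤ => f.coeff a) (sub_eq_zero.1 h)
  simp only [← T_zero, T_apply] at h1
  simp [ha.symm] at h1

@[simp] lemma qb_zero_right (n : ℕ) : qb n 0 = 1 := by
  cases n <;> simp [qb, qbinom]

@[simp] lemma qb_zero_succ (k : ℕ) : qb 0 (k + 1) = 0 := by
  simp [qb, qbinom]

lemma qb_succ_succ (n k : ℕ) :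
    qb (n + 1) (k + 1) = qb n k + T ((k : ℤ) + 1) * qb n (k + 1) := by
  simp [qb, qbinom, Polynomial.toLaurent_X_pow]

lemma qb_eq_zero_of_lt {n k : ℕ} (h : n < k) : qb n k = 0 := by
  induction n generalizing k with
  | zero =>
    obtain ⟨k, rfl⟩ := Nat.exists_eq_add_of_lt h
    simp
  | succ n ih =>
    cases k with
    | zero => omega
    | succ k => rw [qb_succ_succ, ih (by omega), ih (by omega)]; simp

@[simp] lemma qb_self (n : ℕ) : qb n n = 1 := by
  induction n with
  | zero => simp
  | succ n ih => rw [qb_succ_succ, ih, qb_eq_zero_of_lt (Nat.lt_succ_self n)]; simp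

lemma qb_mem_nonnegCoeff (n k : ℕ) : qb n k ∈ nonnegCoeff := by
  induction n generalizing k with
  | zero => cases k <;> simp [one_mem, zero_mem]
  | succ n ih =>
    cases k with
    | zero => simp [one_mem]
    | succ k =>
      rw [qb_succ_succ]
      exact add_mem (ih k) (mul_mem (T_mem_nonnegCoeff _) (ih _))

lemma qbinom_coeff_zero {n k : ℕ} (h : k ≤ n) : (qbinom n k).coeff 0 = 1 := by
  induction n generalizing k with
  | zero =>
    obtain rfl : k = 0 := by omega
    simp [qbinom]
  | succ n ih =>
    cases k with
    | zero => simp [qbinom]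
    | succ k => simp [qbinom, ih (Nat.le_of_succ_le_succ h), Polynomial.mul_coeff_zero]

lemma qb_ne_zero {n k : ℕ} (h : k ≤ n) : qb n k ≠ 0 := by
  intro h0
  have h1 := qbinom_coeff_zero h
  rw [Polynomial.toLaurent_eq_zero.1 h0] at h1
  simp at h1

lemma qb_succ_right (n k : ℕ) :
    (1 - T ((k : ℤ) + 1)) * qb n (k + 1) = (1 - T ((n : ℤ) - k)) * qb n k := by
  induction n generalizing k with
  | zero => cases k <;> simp
  | succ n ih =>
    cases k with
    | zero =>
      have h := ih 0
      have e : (T ((n : ℤ) + 1) : LaurentPolynomial ℤ) = T n * T 1 := T_add _ _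
      rw [qb_succ_succ]
      simp only [Nat.cast_zero, zero_add, sub_zero, qb_zero_right, Nat.cast_succ] at h ⊢
      rw [e]
      linear_combination T 1 * h
    | succ k =>
      have h := ih k
      have h' := ih (k + 1)
      rw [qb_succ_succ, qb_succ_succ n k]
      push_cast at h' ⊢
      rw [show (n : ℤ) + 1 - (k + 1) = n - k by ring]
      have e : (T ((k : ℤ) + 1 + 1) * T ((n : ℤ) - (k + 1)) : LaurentPolynomial ℤ)
          = T ((n : ℤ) - k) * T ((k : ℤ) + 1) := by
        rw [← T_add, ← T_add]; congr 1; ring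
      linear_combination h + T ((k : ℤ) + 1 + 1) * h' - qb n (k + 1) * e

lemma qb_succ_succ' (n k : ℕ) :
    qb (n + 1) (k + 1) = T ((n : ℤ) - k) * qb n k + qb n (k + 1) := by
  rw [qb_succ_succ]
  linear_combination -qb_succ_right n k

lemma qb_succ_succ_mul (n k : ℕ) :
    (1 - T ((k : ℤ) + 1)) * qb (n + 1) (k + 1) = (1 - T ((n : ℤ) + 1)) * qb n k := by
  have e : (T ((n : ℤ) + 1) : LaurentPolynomial ℤ) = T ((k : ℤ) + 1) * T ((n : ℤ) - k) := by
    rw [← T_add]; congr 1; ring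
  rw [qb_succ_succ, e]
  linear_combination T ((k : ℤ) + 1) * qb_succ_right n k

lemma qb_succ_left (n k : ℕ) :
    (1 - T ((n : ℤ) + 1 - k)) * qb (n + 1) k = (1 - T ((n : ℤ) + 1)) * qb n k := by
  cases k with
  | zero => simp
  | succ k =>
    have e : (T ((n : ℤ) + 1) : LaurentPolynomial ℤ) = T ((k : ℤ) + 1) * T ((n : ℤ) - k) := by
      rw [← T_add]; congr 1; ring
    rw [qb_succ_succ, e]
    push_cast
    rw [show (n : ℤ) + 1 - (k + 1) = n - k by ring]
    linear_combination -qb_succ_right n k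

/-- The normalised product `q^{-jn} [n choose j]_q [n+j choose j]_q`; as a function of `n` it is,
up to a constant, the Newton polynomial `∏_{l<j} (y - λ_l)` in `y = q^{-n} + q^{n+1}` with nodes
`λ_l = q^{-l} + q^{l+1}`. -/
noncomputable def qNewton (n j : ℕ) : LaurentPolynomial ℤ :=
  T (-((j : ℤ) * n)) * qb n j * qb (n + j) j

/-- The nodes `q^{-l} + q^{l+1}` of the Newton basis `qNewton`. -/
noncomputable def qNode (l : ℕ) : LaurentPolynomial ℤ := T (-(l : ℤ)) + T ((l : ℤ) + 1)

lemma T_mul_qNode_sub (a b : ℕ) :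
    T (a : ℤ) * (qNode a - qNode b)
      = (1 - T ((a : ℤ) - b)) * (1 - T ((a : ℤ) + b + 1)) := by
  simp only [qNode, mul_sub, sub_mul, mul_add, ← T_add, mul_one, one_mul]
  rw [show (a : ℤ) + -a = 0 by ring, show (a : ℤ) + -b = a - b by ring,
    show (a : ℤ) - b + (a + b + 1) = a + (a + 1) by ring,
    show (a : ℤ) + (b + 1) = a + b + 1 by ring, T_zero]
  ring

lemma qNewton_succ (n j : ℕ) :
    (1 - T ((j : ℤ) + 1)) ^ 2 * qNewton n (j + 1) = (qNode n - qNode j) * qNewton n j := by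
  have h1 := qb_succ_right n j
  have h2 := qb_succ_succ_mul (n + j) j
  have h3 := T_mul_qNode_sub n j
  have e : (T (-((j : ℤ) * n)) : LaurentPolynomial ℤ)
      = T (-(((j : ℤ) + 1) * n)) * T n := by
    rw [← T_add]; congr 1; ring
  unfold qNewton
  rw [← add_assoc, e]
  push_cast at h2 ⊢
  calc _ = T (-(((j : ℤ) + 1) * n)) * ((1 - T ((j : ℤ) + 1)) * qb n (j + 1))
        * ((1 - T ((j : ℤ) + 1)) * qb (n + j + 1) (j + 1)) := by ring
    _ = _ := by
      rw [h1, h2]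
      linear_combination -(T (-(((j : ℤ) + 1) * n)) * qb n j * qb (n + j) j) * h3

/-- The coefficient of `qNewton n (i + s)` in the expansion of `qNewton n k * qNewton n i`. -/
noncomputable def qNewtonCoeff (i k s : ℕ) : LaurentPolynomial ℤ :=
  T (-(((i : ℤ) + s) * (k - s))) * qb (k + i) i * qb k s * qb (i + s) k

lemma qNewtonCoeff_mem_nonnegCoeff (i k s : ℕ) : qNewtonCoeff i k s ∈ nonnegCoeff :=
  mul_mem (mul_mem (mul_mem (T_mem_nonnegCoeff _) (qb_mem_nonnegCoeff _ _))
    (qb_mem_nonnegCoeff _ _)) (qb_mem_nonnegCoeff _ _)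

lemma qNewtonCoeff_eq_zero_of_lt (i : ℕ) {k s : ℕ} (h : k < s) : qNewtonCoeff i k s = 0 := by
  simp [qNewtonCoeff, qb_eq_zero_of_lt h]

lemma qb_add_succ_left (i k : ℕ) :
    (1 - T ((k : ℤ) + 1)) * qb (k + 1 + i) i = (1 - T ((k : ℤ) + 1 + i)) * qb (k + i) i := by
  have h := qb_succ_left (k + i) i
  push_cast at h
  rw [show (k : ℤ) + i + 1 - i = k + 1 by ring, show (k : ℤ) + i + 1 = k + 1 + i by ring] at h
  rwa [show k + 1 + i = k + i + 1 by ring]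

lemma qNewtonCoeff_succ_zero (i k : ℕ) :
    (1 - T ((k : ℤ) + 1)) ^ 2 * qNewtonCoeff i (k + 1) 0
      = (qNode i - qNode k) * qNewtonCoeff i k 0 := by
  have h1 := qb_add_succ_left i k
  have h2 := qb_succ_right i k
  have h3 := T_mul_qNode_sub i k
  have e : (T (-((i : ℤ) * k)) : LaurentPolynomial ℤ) = T (-((i : ℤ) * (k + 1))) * T i := by
    rw [← T_add]; congr 1; ring
  simp only [qNewtonCoeff, qb_zero_right, Nat.cast_zero, add_zero, sub_zero, mul_one, e]
  push_cast
  calc _ = T (-((i : ℤ) * (k + 1))) * ((1 - T ((k : ℤ) + 1)) * qb (k + 1 + i) i)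
        * ((1 - T ((k : ℤ) + 1)) * qb i (k + 1)) := by ring
    _ = _ := by
      rw [h1, h2, show (k : ℤ) + 1 + i = i + k + 1 by ring]
      linear_combination -(T (-((i : ℤ) * (k + 1))) * qb (k + i) i * qb i k) * h3

lemma qNewtonCoeff_succ_succ (i k s : ℕ) :
    (1 - T ((k : ℤ) + 1)) ^ 2 * qNewtonCoeff i (k + 1) (s + 1)
      = (1 - T (((i + s : ℕ) : ℤ) + 1)) ^ 2 * qNewtonCoeff i k s
        + (qNode (i + (s + 1)) - qNode k) * qNewtonCoeff i k (s + 1) := by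
  have h1 := qb_add_succ_left i k
  have h2 := qb_succ_right (i + s + 1) k
  have h3 := T_mul_qNode_sub (i + s + 1) k
  have h4 := qb_succ_left (i + s) k
  have h5 := qb_succ_succ k s
  have h6 := qb_succ_succ' k s
  simp only [qNewtonCoeff, ← add_assoc]
  push_cast at h2 h3 h4 ⊢
  have e1 : (T (-(((i : ℤ) + s) * (k - s))) : LaurentPolynomial ℤ)
      = T (-(((i : ℤ) + s + 1) * (k - s))) * T ((k : ℤ) - s) := by
    rw [← T_add]; congr 1; ring
  have e2 : (T (-(((i : ℤ) + s + 1) * (k - (s + 1)))) : LaurentPolynomial ℤ)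
      = T (-(((i : ℤ) + s + 1) * (k - s))) * T ((i : ℤ) + s + 1) := by
    rw [← T_add]; congr 1; ring
  have e3 : (T ((i : ℤ) + s + 1) * T ((k : ℤ) - s) : LaurentPolynomial ℤ)
      = T ((k : ℤ) + 1 + i) := by
    rw [← T_add]; congr 1; ring
  have e4 : (T ((i : ℤ) + s + 1 + k + 1) : LaurentPolynomial ℤ)
      = T ((k : ℤ) + 1 + i) * T ((s : ℤ) + 1) := by
    rw [← T_add]; congr 1; ring
  rw [show (k : ℤ) + 1 - (s + 1) = k - s by ring, ← add_assoc (i : ℤ) s 1, e1, e2]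
  rw [e4] at h3
  have key : (1 - T ((k : ℤ) + 1 + i)) * qb (k + 1) (s + 1)
      = (1 - T ((i : ℤ) + s + 1)) * T ((k : ℤ) - s) * qb k s
        + (1 - T ((k : ℤ) + 1 + i) * T ((s : ℤ) + 1)) * qb k (s + 1) := by
    linear_combination h6 - T ((k : ℤ) + 1 + i) * h5 + qb k s * e3
  set w : LaurentPolynomial ℤ := T (-(((i : ℤ) + s + 1) * (k - s)))
  calc _ = w * ((1 - T ((k : ℤ) + 1)) * qb (k + 1 + i) i) * qb (k + 1) (s + 1)
        * ((1 - T ((k : ℤ) + 1)) * qb (i + s + 1) (k + 1)) := by ring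
    _ = _ := by
      rw [h1, h2]
      linear_combination
        w * qb (k + i) i * (1 - T ((i : ℤ) + s + 1 - k)) * qb (i + s + 1) k * key
        + w * qb (k + i) i * (1 - T ((i : ℤ) + s + 1)) * T ((k : ℤ) - s) * qb k s * h4
        - w * qb (k + i) i * qb k (s + 1) * qb (i + s + 1) k * h3

theorem qNewton_mul_qNewton (n k i : ℕ) :
    qNewton n k * qNewton n i
      = ∑ s ∈ range (k + 1), qNewtonCoeff i k s * qNewton n (i + s) := by
  induction k with
  | zero => simp [qNewton, qNewtonCoeff]
  | succ k ih =>
    have hne : ((1 - T ((k : ℤ) + 1)) ^ 2 : LaurentPolynomial ℤ) ≠ 0 :=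
      pow_ne_zero _ (one_sub_T_ne_zero (by positivity))
    apply mul_left_cancel₀ hne
    have hext : ∑ s ∈ range (k + 1),
          (qNode (i + s) - qNode k) * qNewtonCoeff i k s * qNewton n (i + s)
        = ∑ s ∈ range (k + 1 + 1),
          (qNode (i + s) - qNode k) * qNewtonCoeff i k s * qNewton n (i + s) := by
      rw [sum_range_succ _ (k + 1), qNewtonCoeff_eq_zero_of_lt i (Nat.lt_succ_self k)]
      simp
    calc _ = (qNode n - qNode k) * (qNewton n k * qNewton n i) := by
          rw [← mul_assoc, qNewton_succ, mul_assoc]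
      _ = ∑ s ∈ range (k + 1),
            (1 - T (((i + s : ℕ) : ℤ) + 1)) ^ 2 * qNewtonCoeff i k s * qNewton n (i + (s + 1))
          + ∑ s ∈ range (k + 1),
            (qNode (i + s) - qNode k) * qNewtonCoeff i k s * qNewton n (i + s) := by
          rw [ih, mul_sum, ← sum_add_distrib]
          refine sum_congr rfl fun s _ => ?_
          linear_combination -qNewtonCoeff i k s * qNewton_succ n (i + s)
      _ = _ := by
          rw [hext, sum_range_succ' _ (k + 1), sum_range_succ' _ (k + 1), ← add_assoc,
            ← sum_add_distrib, mul_add, mul_sum]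
          congr 1
          · refine sum_congr rfl fun s _ => ?_
            rw [← mul_assoc, qNewtonCoeff_succ_succ]
            ring
          · rw [← mul_assoc, qNewtonCoeff_succ_zero]
            rfl

theorem exists_qNewton_pow_eq_sum (k r : ℕ) (hr : 1 ≤ r) :
    ∃ P : ℕ → LaurentPolynomial ℤ,
      (∀ i : ℕ, i < k ∨ r * k < i → P i = 0) ∧ (∀ i, P i ∈ nonnegCoeff) ∧
      ∀ n : ℕ, qNewton n k ^ r = ∑ i ∈ Icc k (r * k), qNewton n i * P i := by
  induction r, hr using Nat.le_induction with
  | base =>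
    refine ⟨fun i => if i = k then 1 else 0, fun i hi => if_neg (by omega), fun i => ?_,
      fun n => by simp⟩
    dsimp only
    split_ifs
    exacts [one_mem _, zero_mem _]
  | succ r _ ih =>
    obtain ⟨P, hsupp, hpos, hsum⟩ := ih
    refine ⟨fun j => ∑ i ∈ Icc k (r * k), ∑ s ∈ range (k + 1),
      if j = i + s then P i * qNewtonCoeff i k s else 0, fun j hj => ?_, fun j => ?_, fun n => ?_⟩
    · refine sum_eq_zero fun i hi => sum_eq_zero fun s hs => if_neg ?_
      rw [mem_Icc] at hi
      rw [mem_range] at hs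
      rw [add_mul] at hj
      omega
    · refine sum_mem fun i _ => sum_mem fun s _ => ?_
      split_ifs
      exacts [mul_mem (hpos i) (qNewtonCoeff_mem_nonnegCoeff i k s), zero_mem _]
    · rw [pow_succ, hsum, sum_mul]
      simp only [mul_sum]
      rw [sum_comm]
      refine sum_congr rfl fun i hi => ?_
      rw [sum_comm, mul_right_comm, mul_comm (qNewton n i), qNewton_mul_qNewton, sum_mul]
      refine sum_congr rfl fun s hs => ?_
      rw [mem_Icc] at hi
      rw [mem_range] at hs
      have hmem : i + s ∈ Icc k ((r + 1) * k) := by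
        rw [mem_Icc, add_mul]
        omega
      simp only [mul_ite, mul_zero, sum_ite_eq', hmem, if_true]
      ring

/-- **Lemma 1.2.** For all `k ≥ 0` and `r ≥ 1` there is a unique sequence of Laurent
polynomials `P_{k,i}^{(r)}(q)`, supported on `k ≤ i ≤ rk` and with nonnegative integer
coefficients, such that for all `n ≥ k`:
`[n,k]_q^r [n+k,k]_q^r = ∑_{i=k}^{min(n,rk)} q^{(rk-i)n} [n,i]_q [n+i,i]_q P_{k,i}^{(r)}(q)`. -/
theorem qSchmidt_lemma (k r : ℕ) (hr : 1 ≤ r) :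
    ∃! P : ℕ → LaurentPolynomial ℤ,
      (∀ i : ℕ, i < k ∨ r * k < i → P i = 0) ∧
      (∀ i : ℕ, ∀ m : ℤ, 0 ≤ (P i).coeff m) ∧
      ∀ n : ℕ, k ≤ n →
        qb n k ^ r * qb (n + k) k ^ r
        = ∑ i ∈ Icc k (min n (r * k)),
            T (((r : ℤ) * k - i) * n) * qb n i * qb (n + i) i * P i := by
  obtain ⟨P, hsupp, hpos, hsum⟩ := exists_qNewton_pow_eq_sum k r hr
  refine existsUnique_of_exists_of_unique ⟨P, hsupp, hpos, fun n _ => ?_⟩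
    fun P Q ⟨hP, _, hP'⟩ ⟨hQ, _, hQ'⟩ => funext fun n => ?_
  · have e : (T ((r : ℤ) * k * n) * T (-((k : ℤ) * n)) ^ r : LaurentPolynomial ℤ) = 1 := by
      rw [T_pow, ← T_add, ← T_zero]; congr 1; ring
    have hpow : qb n k ^ r * qb (n + k) k ^ r = T ((r : ℤ) * k * n) * qNewton n k ^ r := by
      rw [qNewton, mul_pow, mul_pow, ← mul_assoc, ← mul_assoc, e, one_mul]
    rw [hpow, hsum, mul_sum]
    symm
    apply sum_subset_zero_on_sdiff (Icc_subset_Icc_right (min_le_right _ _))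
    · intro i hi
      rw [mem_sdiff, mem_Icc, mem_Icc] at hi
      rw [qNewton, qb_eq_zero_of_lt (by omega : n < i)]
      simp
    · intro i _
      have e' : (T (((r : ℤ) * k - i) * n) : LaurentPolynomial ℤ)
          = T ((r : ℤ) * k * n) * T (-((i : ℤ) * n)) := by
        rw [← T_add]; congr 1; ring
      rw [e', qNewton]
      ring
  · induction n using Nat.strong_induction_on with
    | _ n ih =>
      by_cases hn : n < k ∨ r * k < n
      · rw [hP n hn, hQ n hn]
      · have h := (hP' n (by omega)).symm.trans (hQ' n (by omega))
        have hmem : n ∈ Icc k n := right_mem_Icc.2 (by omega)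
        have hlower : ∀ i ∈ (Icc k n).erase n,
            T (((r : ℤ) * k - i) * n) * qb n i * qb (n + i) i * P i
              = T (((r : ℤ) * k - i) * n) * qb n i * qb (n + i) i * Q i := fun i hi => by
          rw [mem_erase, mem_Icc] at hi
          rw [ih i (by omega)]
        rw [min_eq_left (by omega), ← add_sum_erase _ _ hmem, ← add_sum_erase _ _ hmem,
          sum_congr rfl hlower] at h
        refine mul_left_cancel₀ ?_ (add_right_cancel h)
        exact mul_ne_zero (mul_ne_zero (isUnit_T _).ne_zero (qb_ne_zero le_rfl))
          (qb_ne_zero (Nat.le_add_left n n))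
end

section
/- For all integers 0 ≤ i ≤ n and 0 ≤ k ≤ n, one has [n+k choose n−i]_q · [n+i choose i]_q = ∑_{j=0}^{i} q^{(i−j)(n−k−j)} · [n−k choose j]_q · [k choose i−j]_q · [n+k+j choose n]_q, as an identity of polynomials in q. -/
open Polynomial LaurentPolynomial Finset

theorem qbinom_zero_right (n : ℕ) : qbinom n 0 = 1 := by
  cases n <;> rfl

theorem qbinom_succ_succ (n k : ℕ) :
    qbinom (n + 1) (k + 1) = qbinom n k + Polynomial.X ^ (k + 1) * qbinom n (k + 1) := rfl

theorem qbinom_eq_zero_of_lt {n k : ℕ} (h : n < k) : qbinom n k = 0 := by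
  induction n generalizing k with
  | zero => obtain ⟨k, rfl⟩ := Nat.exists_eq_add_of_lt h; rfl
  | succ n ih =>
    obtain ⟨k, rfl⟩ : ∃ l, k = l + 1 := ⟨k - 1, by omega⟩
    rw [qbinom_succ_succ, ih (by omega), ih (by omega), mul_zero, add_zero]

theorem qbinom_self (n : ℕ) : qbinom n n = 1 := by
  induction n with
  | zero => rfl
  | succ n ih => rw [qbinom_succ_succ, ih, qbinom_eq_zero_of_lt n.lt_succ_self, mul_zero, add_zero]

/-- The `q`-factorial `(q)_n = (1 - q) (1 - q ^ 2) ⋯ (1 - q ^ n)`. -/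
noncomputable def qPochhammer (n : ℕ) : Polynomial ℤ :=
  ∏ m ∈ range n, (1 - Polynomial.X ^ (m + 1))

theorem qPochhammer_succ (n : ℕ) :
    qPochhammer (n + 1) = qPochhammer n * (1 - Polynomial.X ^ (n + 1)) :=
  prod_range_succ _ _

theorem qPochhammer_ne_zero (n : ℕ) : qPochhammer n ≠ 0 := by
  refine prod_ne_zero_iff.2 fun m _ h => ?_
  simpa using congrArg (Polynomial.eval 0) h

theorem qbinom_mul_qPochhammer (a b : ℕ) :
    qbinom (a + b) a * (qPochhammer a * qPochhammer b) = qPochhammer (a + b) := by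
  induction a generalizing b with
  | zero => simp [qbinom_zero_right, qPochhammer]
  | succ a iha =>
    induction b with
    | zero => simp [qbinom_self, qPochhammer]
    | succ b ihb =>
      have h := iha (b + 1)
      rw [show a + 1 + b = a + b + 1 by ring] at ihb
      rw [show a + (b + 1) = a + b + 1 by ring] at h
      rw [show a + 1 + (b + 1) = a + b + 1 + 1 by ring, qbinom_succ_succ,
        qPochhammer_succ (a + b + 1)]
      rw [qPochhammer_succ b] at h ⊢
      rw [qPochhammer_succ a] at ihb ⊢
      linear_combination (1 - Polynomial.X ^ (a + 1)) * h +
        Polynomial.X ^ (a + 1) * (1 - Polynomial.X ^ (b + 1)) * ihb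

theorem qbinom_add_symm (a b : ℕ) : qbinom (a + b) a = qbinom (a + b) b := by
  refine mul_right_cancel₀
    (mul_ne_zero (qPochhammer_ne_zero a) (qPochhammer_ne_zero b)) ?_
  rw [qbinom_mul_qPochhammer, mul_comm (qPochhammer a), add_comm, qbinom_mul_qPochhammer]

/-- Trinomial revision for Gaussian binomial coefficients. -/
theorem qbinom_mul_qbinom (a m b : ℕ) :
    qbinom (a + m) (a + b) * qbinom (a + b) a = qbinom (a + m) a * qbinom m b := by
  rcases lt_or_ge m b with h | h
  · rw [qbinom_eq_zero_of_lt h, qbinom_eq_zero_of_lt (by omega : a + m < a + b), zero_mul, mul_zero]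
  obtain ⟨c, rfl⟩ := Nat.exists_eq_add_of_le h
  have h1 := qbinom_mul_qPochhammer (a + b) c
  have h2 := qbinom_mul_qPochhammer a b
  have h3 := qbinom_mul_qPochhammer a (b + c)
  have h4 := qbinom_mul_qPochhammer b c
  rw [add_assoc] at h1
  refine mul_right_cancel₀ (mul_ne_zero (qPochhammer_ne_zero a)
    (mul_ne_zero (qPochhammer_ne_zero b) (qPochhammer_ne_zero c))) ?_
  linear_combination qbinom (a + (b + c)) (a + b) * qPochhammer c * h2 + h1 - h3
    - qbinom (a + (b + c)) a * qPochhammer a * h4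

/-- The `q`-Vandermonde identity. The truncated subtraction in the exponent is harmless, since
the terms with `b < p.2` vanish. -/
theorem qbinom_add_eq_sum_antidiagonal (a b c : ℕ) :
    qbinom (a + b) c = ∑ p ∈ antidiagonal c,
      Polynomial.X ^ (p.1 * (b - p.2)) * qbinom a p.1 * qbinom b p.2 := by
  induction b generalizing c with
  | zero =>
    cases c with
    | zero => simp [qbinom_zero_right]
    | succ c =>
      rw [Nat.sum_antidiagonal_succ', sum_eq_zero]
      · simp [qbinom_zero_right]
      · intro p _
        rw [qbinom_eq_zero_of_lt (Nat.succ_pos p.2), mul_zero]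
  | succ b ih =>
    cases c with
    | zero => simp [qbinom_zero_right]
    | succ c =>
      rw [← add_assoc, qbinom_succ_succ, ih c, ih (c + 1), Nat.sum_antidiagonal_succ',
        Nat.sum_antidiagonal_succ', mul_add, mul_sum, add_left_comm, ← sum_add_distrib]
      congr 1
      · simp only [qbinom_zero_right, Nat.sub_zero]
        ring
      · refine sum_congr rfl fun p hp => ?_
        rw [HasAntidiagonal.mem_antidiagonal] at hp
        dsimp only
        rw [qbinom_succ_succ, Nat.add_sub_add_right]
        rcases lt_or_ge b (p.2 + 1) with h | h
        · rw [qbinom_eq_zero_of_lt h]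
          ring
        · obtain ⟨d, rfl⟩ := Nat.exists_eq_add_of_le h
          rw [Nat.add_sub_cancel_left, show p.2 + 1 + d - p.2 = d + 1 by omega, ← hp]
          ring

theorem qbinom_add_eq_sum_range (a b c : ℕ) :
    qbinom (a + b) c = ∑ k ∈ range (c + 1),
      Polynomial.X ^ (k * (b - (c - k))) * qbinom a k * qbinom b (c - k) := by
  rw [qbinom_add_eq_sum_antidiagonal, Nat.sum_antidiagonal_eq_sum_range_succ_mk]

theorem qbinom_add_eq_sum_range' (a b c : ℕ) :
    qbinom (a + b) c = ∑ k ∈ range (c + 1),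
      Polynomial.X ^ ((c - k) * (a - k)) * qbinom a k * qbinom b (c - k) := by
  rw [add_comm, qbinom_add_eq_sum_range, ← sum_range_reflect]
  refine sum_congr rfl fun k hk => ?_
  rw [mem_range] at hk
  rw [show c + 1 - 1 - k = c - k by omega, show c - (c - k) = k by omega]
  ring

theorem sum_qbinom_mul_qbinom_mul_qbinom (a b n k : ℕ) (hk : k ≤ n) :
    ∑ j ∈ range (n + 1),
      Polynomial.X ^ ((n - j) * (a - j)) * qbinom a j * qbinom b (n - j) * qbinom j k
      = qbinom a k * qbinom (a + b - k) (n - k) := by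
  obtain ⟨n, rfl⟩ := Nat.exists_eq_add_of_le hk
  rw [add_assoc, sum_range_add, sum_eq_zero, zero_add]
  · rcases lt_or_ge a k with h | h
    · rw [qbinom_eq_zero_of_lt h, zero_mul]
      refine sum_eq_zero fun x _ => ?_
      rw [qbinom_eq_zero_of_lt (by omega : a < k + x)]
      ring
    obtain ⟨a, rfl⟩ := Nat.exists_eq_add_of_le h
    rw [add_assoc, Nat.add_sub_cancel_left, Nat.add_sub_cancel_left,
      qbinom_add_eq_sum_range' a b n, mul_sum]
    refine sum_congr rfl fun x _ => ?_
    rw [Nat.add_sub_add_left, Nat.add_sub_add_left]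
    linear_combination Polynomial.X ^ ((n - x) * (a - x)) * qbinom b (n - x) *
      qbinom_mul_qbinom k a x
  · intro j hj
    rw [qbinom_eq_zero_of_lt (mem_range.1 hj), mul_zero]

/-- The `q`-Pfaff–Saalschütz identity for Gaussian binomial coefficients. -/
theorem sum_qbinom_pfaff_saalschuetz (a b n r : ℕ) (hn : n ≤ a + b) :
    ∑ j ∈ range (n + 1),
      Polynomial.X ^ ((n - j) * (a - j)) * qbinom a j * qbinom b (n - j) * qbinom (r + j) (a + b)
      = qbinom r (a + b - n) * qbinom (a + (r - (a + b - n))) n := by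
  have expand : ∀ j ∈ range (n + 1), qbinom (r + j) (a + b) = ∑ k ∈ range (n + 1),
      Polynomial.X ^ (k * (r - (a + b - k))) * qbinom j k * qbinom r (a + b - k) := by
    intro j hj
    rw [mem_range] at hj
    rw [add_comm r, qbinom_add_eq_sum_range]
    refine (sum_subset (range_subset_range.2 (by omega)) fun k _ hk => ?_).symm
    rw [mem_range] at hk
    rw [qbinom_eq_zero_of_lt (by omega : j < k)]
    ring
  rw [sum_congr rfl fun j hj => by rw [expand j hj, mul_sum], sum_comm,
    qbinom_add_eq_sum_range, mul_sum]
  refine sum_congr rfl fun k hk => ?_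
  have hk : k ≤ n := Nat.lt_succ_iff.1 (mem_range.1 hk)
  have inner := sum_qbinom_mul_qbinom_mul_qbinom a b n k hk
  trans Polynomial.X ^ (k * (r - (a + b - k))) * qbinom r (a + b - k) *
      (qbinom a k * qbinom (a + b - k) (n - k))
  · rw [← inner, mul_sum]
    exact sum_congr rfl fun j _ => by ring
  obtain ⟨d, hd⟩ := Nat.exists_eq_add_of_le' hn
  rw [show a + b - k = d + (n - k) by omega, show a + b - n = d by omega]
  rcases lt_or_ge r d with h | h
  · rw [qbinom_eq_zero_of_lt h, qbinom_eq_zero_of_lt (by omega : r < d + (n - k))]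
    ring
  obtain ⟨e, rfl⟩ := Nat.exists_eq_add_of_le h
  rw [Nat.add_sub_add_left, Nat.add_sub_cancel_left, ← qbinom_add_symm]
  linear_combination Polynomial.X ^ (k * (e - (n - k))) * qbinom a k *
    qbinom_mul_qbinom d e (n - k)

/-- The specialization of the q-Pfaff–Saalschütz identity: for `0 ≤ i ≤ n` and
`0 ≤ k ≤ n`:
`[n+k,n-i]_q [n+i,i]_q = ∑_{j=0}^i q^{(i-j)(n-k-j)} [n-k,j]_q [k,i-j]_q [n+k+j,n]_q`. -/
theorem q_pfaff_saalschuetz_special (n i k : ℕ) (hi : i ≤ n) (hk : k ≤ n) :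
    qb (n + k) (n - i) * qb (n + i) i
      = ∑ j ∈ range (i + 1),
          T (((i : ℤ) - j) * ((n : ℤ) - k - j)) *
            qb (n - k) j * qb k (i - j) * qb (n + k + j) n := by
  have h := sum_qbinom_pfaff_saalschuetz (n - k) k i (n + k) (by omega)
  rw [Nat.sub_add_cancel hk, show n - k + (n + k - (n - i)) = n + i by omega] at h
  simp only [qb]
  rw [← map_mul, ← h, map_sum]
  refine sum_congr rfl fun j hj => ?_
  have hj : j ≤ i := Nat.lt_succ_iff.1 (mem_range.1 hj)
  rcases lt_or_ge (n - k) j with hlt | hle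
  · simp [qbinom_eq_zero_of_lt hlt]
  · have hexp : (((i - j) * (n - k - j) : ℕ) : ℤ) = ((i : ℤ) - j) * ((n : ℤ) - k - j) := by
      rw [Nat.cast_mul, Nat.cast_sub hj, Nat.cast_sub hle, Nat.cast_sub hk]
    rw [map_mul, map_mul, map_mul, Polynomial.toLaurent_X_pow, hexp]
end
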